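/- Let Ω⁺ ⊂ ℝ³ be a bounded open set. Suppose Ω⁻₁ and Ω⁻₂ are measurable sets of finite measure, each disjoint from Ω⁺ up to a null set, such that for i = 1, 2 the potential φ_i(x) := ∫_{ℝ³} (χ_{Ω⁺}(y) − χ_{Ω⁻ᵢ}(y))/(4π|x−y|) dy satisfies φ_i ≥ 0 on ℝ³ and φ_i = 0 almost everywhere on ℝ³ \ (Ω⁺ ∪ Ω⁻ᵢ). Then φ₁ = φ₂ on ℝ³ and |Ω⁻₁ △ Ω⁻₂| = 0; i.e., the screening property uniquely determines the configuration up to a null set. -/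

import Mathlib

open MeasureTheory Real

noncomputable section

abbrev E3 := EuclideanSpace ℝ (Fin 3)

/-- The Coulomb kernel in ℝ³. -/
def coul (x y : E3) : ℝ := 1 / (4 * π * ‖x - y‖)

/-- The potential `φ` generated by the charges `χ_{Ω⁺} − χ_{Ω⁻}`. -/
def potential (Ωp Ωm : Set E3) (x : E3) : ℝ :=
  ∫ y, (Set.indicator Ωp (fun _ => (1:ℝ)) y - Set.indicator Ωm (fun _ => (1:ℝ)) y) * coul x y

open Filter Topology Set

lemma E3.finrank_eq : Module.finrank ℝ E3 = 3 := by simp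

lemma integrable_exp_neg_mul_norm_sq {b : ℝ} (hb : 0 < b) :
    Integrable (fun v : E3 => exp (-b * ‖v‖ ^ 2)) :=
  .of_integral_ne_zero <| by
    rw [GaussianFourier.integral_rexp_neg_mul_sq_norm hb]; positivity

lemma measurable_coul : Measurable (fun p : E3 × E3 => coul p.1 p.2) := by
  unfold coul; fun_prop

lemma coul_nonneg (x y : E3) : 0 ≤ coul x y := by unfold coul; positivity

/-- The Coulomb kernel, truncated to the unit ball. -/
def coulNear (v : E3) : ℝ := (Metric.ball (0 : E3) 1).indicator (fun v => 1 / (4 * π * ‖v‖)) v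

lemma integrable_coulNear : Integrable coulNear := by
  unfold coulNear
  rw [integrable_indicator_iff measurableSet_ball]
  refine (integrableOn_fun_norm_addHaar (volume : Measure E3) (f := fun r : ℝ => 1 / (4 * π * r))
    (r := 1)).2 ?_
  have h : IntegrableOn (fun y : ℝ => y / (4 * π)) (Ioo 0 1) :=
    ((by fun_prop : Continuous fun y : ℝ => y / (4 * π)).integrableOn_Icc (a := 0) (b := 1)).mono_set
      Ioo_subset_Icc_self
  refine h.congr_fun (fun y hy => ?_) measurableSet_Ioo
  have := hy.1.ne'
  simp only [E3.finrank_eq, smul_eq_mul]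
  field_simp

lemma coul_le (x y : E3) : coul x y ≤ coulNear (x - y) + 1 := by
  unfold coul coulNear
  by_cases h : x - y ∈ Metric.ball (0 : E3) 1
  · rw [indicator_of_mem h]; linarith
  · rw [indicator_of_notMem h, zero_add]
    have h1 : 1 ≤ ‖x - y‖ := by simpa using h
    have := pi_gt_three
    rw [div_le_one (by positivity)]
    nlinarith

lemma coulNear_nonneg (v : E3) : 0 ≤ coulNear v :=
  indicator_nonneg (fun _ _ => by positivity) _

lemma norm_mul_coul_le {σ : E3 → ℝ} (hσ : ∀ y, |σ y| ≤ 1) (x y : E3) :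
    ‖σ y * coul x y‖ ≤ coulNear (x - y) + |σ y| := by
  rw [norm_mul, norm_eq_abs, norm_of_nonneg (coul_nonneg x y)]
  calc |σ y| * coul x y ≤ |σ y| * (coulNear (x - y) + 1) := by gcongr; exact coul_le x y
    _ ≤ _ := by nlinarith [hσ y, coulNear_nonneg (x - y)]

lemma integrable_mul_coul {σ : E3 → ℝ} (hσ : ∀ y, |σ y| ≤ 1) (hm : Measurable σ)
    (hi : Integrable σ) (x : E3) : Integrable (fun y => σ y * coul x y) :=
  ((integrable_coulNear.comp_sub_left x).add hi.abs).mono'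
    (hm.mul (measurable_coul.comp measurable_prodMk_left)).aestronglyMeasurable
    (ae_of_all _ (norm_mul_coul_le hσ x))

lemma integrable_mul_mul_coul {σ : E3 → ℝ} (hσ : ∀ y, |σ y| ≤ 1) (hm : Measurable σ)
    (hi : Integrable σ) : Integrable (fun p : E3 × E3 => σ p.1 * σ p.2 * coul p.1 p.2) := by
  have hmeas : Measurable (fun p : E3 × E3 => σ p.1 * σ p.2 * coul p.1 p.2) :=
    ((hm.comp measurable_fst).mul (hm.comp measurable_snd)).mul measurable_coul
  refine (integrable_prod_iff hmeas.aestronglyMeasurable).2 ⟨ae_of_all _ fun x => ?_, ?_⟩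
  · simpa only [mul_assoc] using (integrable_mul_coul hσ hm hi x).const_mul (σ x)
  · refine (hi.abs.mul_const ((∫ v, coulNear v) + ∫ y, |σ y|)).mono'
      hmeas.norm.stronglyMeasurable.integral_prod_right.aestronglyMeasurable
      (ae_of_all _ fun x => ?_)
    rw [norm_of_nonneg (integral_nonneg fun _ => norm_nonneg _)]
    simp only [mul_assoc, norm_mul (σ x), integral_const_mul, ← norm_eq_abs (σ x)]
    gcongr
    rw [← integral_sub_left_eq_self coulNear volume x,
      ← integral_add (integrable_coulNear.comp_sub_left x) hi.abs]
    exact integral_mono (integrable_mul_coul hσ hm hi x).norm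
      ((integrable_coulNear.comp_sub_left x).add hi.abs) (norm_mul_coul_le hσ x)

/-- The product of Gaussians which, integrated in `t > 0` and `z`, reproduces the Coulomb kernel. -/
def gaussPair (x y : E3) (q : ℝ × E3) : ℝ :=
  q.1 * (exp (-(2 * q.1) * ‖x - q.2‖ ^ 2) * exp (-(2 * q.1) * ‖y - q.2‖ ^ 2))

lemma gaussPair_eq (x y : E3) (t : ℝ) (z : E3) :
    gaussPair x y (t, z) = t * exp (-t * ‖x - y‖ ^ 2) *
      exp (-(4 * t) * ‖(1 / 2 : ℝ) • (x + y) - z‖ ^ 2) := by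
  have h := parallelogram_law_with_norm ℝ (x - z) (y - z)
  have h1 : x - z + (y - z) = (2 : ℝ) • ((1 / 2 : ℝ) • (x + y) - z) := by module
  have h2 : x - z - (y - z) = x - y := by abel
  rw [h1, h2, norm_smul, norm_of_nonneg zero_le_two] at h
  unfold gaussPair
  rw [mul_assoc, ← exp_add, ← exp_add]
  congr 2
  linear_combination t * h

lemma integral_gaussPair_snd (x y : E3) {t : ℝ} (ht : 0 < t) :
    ∫ z, gaussPair x y (t, z) =
      (π / 4) ^ (3 / 2 : ℝ) * (t ^ ((1 / 2 : ℝ) - 1) * exp (-(‖x - y‖ ^ 2 * t))) := by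
  simp only [gaussPair_eq]
  rw [integral_const_mul, integral_sub_left_eq_self (fun v : E3 => exp (-(4 * t) * ‖v‖ ^ 2)),
    GaussianFourier.integral_rexp_neg_mul_sq_norm (by positivity), E3.finrank_eq]
  have h : t * (π / (4 * t)) ^ (3 / 2 : ℝ) = (π / 4) ^ (3 / 2 : ℝ) * t ^ ((1 / 2 : ℝ) - 1) := by
    rw [← div_div, div_rpow (by positivity) ht.le, mul_div_assoc', mul_comm, mul_div_assoc]
    congr 1
    rw [show ((1 / 2 : ℝ) - 1) = 1 - 3 / 2 by norm_num, rpow_sub ht, rpow_one]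
  push_cast
  rw [mul_right_comm, h, show -t * ‖x - y‖ ^ 2 = -(‖x - y‖ ^ 2 * t) by ring, mul_assoc]

/-- The normalisation constant in the Gaussian representation of the Coulomb kernel. -/
def gaussConst : ℝ := (π / 4) ^ (3 / 2 : ℝ) * (4 * π) * Gamma (1 / 2)

lemma gaussConst_pos : 0 < gaussConst := by
  have := Gamma_pos_of_pos (s := 1 / 2) (by norm_num)
  unfold gaussConst; positivity

lemma integral_integral_gaussPair {x y : E3} (h : x ≠ y) :
    ∫ t in Ioi (0 : ℝ), ∫ z, gaussPair x y (t, z) = gaussConst * coul x y := by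
  have hr : 0 < ‖x - y‖ := norm_pos_iff.2 (sub_ne_zero.2 h)
  rw [setIntegral_congr_fun measurableSet_Ioi fun t ht => integral_gaussPair_snd x y ht,
    integral_const_mul, integral_rpow_mul_exp_neg_mul_Ioi (by norm_num) (by positivity),
    ← sqrt_eq_rpow, sqrt_div zero_le_one, sqrt_one, sqrt_sq hr.le]
  unfold gaussConst coul
  field_simp

lemma measurable_gaussPair : Measurable fun p : (E3 × E3) × (ℝ × E3) =>
    gaussPair p.1.1 p.1.2 p.2 := by
  unfold gaussPair; fun_prop

lemma gaussPair_nonneg (x y : E3) {t : ℝ} (ht : 0 < t) (z : E3) : 0 ≤ gaussPair x y (t, z) := by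
  unfold gaussPair; positivity

lemma ae_restrict_prod_fst_pos :
    ∀ᵐ q ∂((volume.restrict (Ioi (0 : ℝ))).prod (volume : Measure E3)), 0 < q.1 :=
  Measure.quasiMeasurePreserving_fst.ae (ae_restrict_mem measurableSet_Ioi)

lemma coul_pos {x y : E3} (h : x ≠ y) : 0 < coul x y := by
  have hr : 0 < ‖x - y‖ := norm_pos_iff.2 (sub_ne_zero.2 h)
  unfold coul
  positivity

lemma integrable_gaussPair_snd (x y : E3) {t : ℝ} (ht : 0 < t) :
    Integrable (fun z => gaussPair x y (t, z)) := by
  have ht' : 0 < 4 * t := mul_pos four_pos ht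
  simp only [gaussPair_eq]
  exact ((integrable_exp_neg_mul_norm_sq ht').comp_sub_left ((1 / 2 : ℝ) • (x + y))).const_mul
    (t * exp (-t * ‖x - y‖ ^ 2))

lemma integrableOn_integral_gaussPair {x y : E3} (h : x ≠ y) :
    IntegrableOn (fun t => ∫ z, gaussPair x y (t, z)) (Ioi 0) := by
  have h0 : ∫ t in Ioi (0 : ℝ), ∫ z, gaussPair x y (t, z) ≠ 0 := by
    rw [integral_integral_gaussPair h]
    exact (mul_pos gaussConst_pos (coul_pos h)).ne'
  exact Integrable.of_integral_ne_zero h0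

lemma integrable_gaussPair {x y : E3} (h : x ≠ y) :
    Integrable (gaussPair x y) ((volume.restrict (Ioi 0)).prod volume) := by
  have hm : Measurable (gaussPair x y) := by unfold gaussPair; fun_prop
  refine (integrable_prod_iff hm.aestronglyMeasurable).2 ⟨?_, ?_⟩
  · filter_upwards [ae_restrict_mem measurableSet_Ioi] with t ht
    exact integrable_gaussPair_snd x y ht
  · refine (integrableOn_integral_gaussPair h).congr ?_
    filter_upwards [ae_restrict_mem measurableSet_Ioi] with t ht
    exact integral_congr_ae (ae_of_all _ fun z => (norm_of_nonneg (gaussPair_nonneg x y ht z)).symm)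

lemma integral_gaussPair {x y : E3} (h : x ≠ y) :
    ∫ q, gaussPair x y q ∂((volume.restrict (Ioi 0)).prod volume) = gaussConst * coul x y := by
  rw [integral_prod _ (integrable_gaussPair h), integral_integral_gaussPair h]

lemma ae_fst_ne_snd : ∀ᵐ p : E3 × E3, p.1 ≠ p.2 := by
  refine (Measure.ae_prod_iff_ae_ae (p := fun p : E3 × E3 => p.1 ≠ p.2)
    (measurableSet_eq_fun measurable_fst measurable_snd).compl).2 (ae_of_all _ fun x => ?_)
  filter_upwards [compl_mem_ae_iff.2 (measure_singleton x)] with y hy h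
  exact hy h.symm

/-- The Gaussian average of `σ`. -/
def gaussAvg (σ : E3 → ℝ) (t : ℝ) (z : E3) : ℝ := ∫ x, σ x * exp (-(2 * t) * ‖x - z‖ ^ 2)

lemma ae_gaussAvg_eq_zero {σ : E3 → ℝ} (hσ : ∀ y, |σ y| ≤ 1) (hm : Measurable σ)
    (hi : Integrable σ) (hE : ∫ p : E3 × E3, σ p.1 * σ p.2 * coul p.1 p.2 ≤ 0) :
    ∀ᵐ t ∂(volume.restrict (Ioi (0 : ℝ))), ∀ᵐ z, gaussAvg σ t z = 0 := by
  set ν : Measure (ℝ × E3) := (volume.restrict (Ioi 0)).prod volume with hν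
  let H : E3 × E3 → ℝ × E3 → ℝ := fun p q => σ p.1 * σ p.2 * gaussPair p.1 p.2 q
  have hHm : Measurable (Function.uncurry H) :=
    ((hm.comp (measurable_fst.comp measurable_fst)).mul
      (hm.comp (measurable_snd.comp measurable_fst))).mul measurable_gaussPair
  have hHi : Integrable (Function.uncurry H) (volume.prod ν) := by
    refine (integrable_prod_iff hHm.aestronglyMeasurable).2 ⟨?_, ?_⟩
    · filter_upwards [ae_fst_ne_snd] with p hp
      exact (integrable_gaussPair hp).const_mul (σ p.1 * σ p.2)
    · refine ((integrable_mul_mul_coul hσ hm hi).norm.const_mul gaussConst).congr ?_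
      filter_upwards [ae_fst_ne_snd] with p hp
      simp only [Function.uncurry, H, norm_mul (σ p.1 * σ p.2), integral_const_mul]
      rw [integral_congr_ae (g := gaussPair p.1 p.2), integral_gaussPair hp,
        norm_of_nonneg (coul_nonneg _ _)]
      · ring
      · filter_upwards [ae_restrict_prod_fst_pos] with q hq
        exact norm_of_nonneg (gaussPair_nonneg _ _ hq _)
  have hswap := integral_integral_swap hHi
  have hleft : ∫ p, ∫ q, H p q ∂ν = gaussConst * ∫ p : E3 × E3, σ p.1 * σ p.2 * coul p.1 p.2 := by
    rw [← integral_const_mul]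
    refine integral_congr_ae ?_
    filter_upwards [ae_fst_ne_snd] with p hp
    simp only [H, integral_const_mul, hν, integral_gaussPair hp]
    ring
  have hright : ∀ q : ℝ × E3, ∫ p, H p q = q.1 * gaussAvg σ q.1 q.2 ^ 2 := fun q => by
    have : ∀ p : E3 × E3, H p q = q.1 * ((σ p.1 * exp (-(2 * q.1) * ‖p.1 - q.2‖ ^ 2)) *
        (σ p.2 * exp (-(2 * q.1) * ‖p.2 - q.2‖ ^ 2))) := fun p => by
      simp only [H, gaussPair]; ring
    simp only [this, integral_const_mul, Measure.volume_eq_prod]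
    rw [integral_prod_mul (fun x : E3 => σ x * exp (-(2 * q.1) * ‖x - q.2‖ ^ 2))
      (fun x : E3 => σ x * exp (-(2 * q.1) * ‖x - q.2‖ ^ 2)), sq]
    rfl
  have hint : Integrable (fun q : ℝ × E3 => q.1 * gaussAvg σ q.1 q.2 ^ 2) ν := by
    simpa only [Function.uncurry, hright] using hHi.integral_prod_right
  have hnn : 0 ≤ᵐ[ν] fun q => q.1 * gaussAvg σ q.1 q.2 ^ 2 := by
    filter_upwards [ae_restrict_prod_fst_pos] with q hq
    exact mul_nonneg hq.le (sq_nonneg _)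
  have hzero : ∫ q, q.1 * gaussAvg σ q.1 q.2 ^ 2 ∂ν = 0 := by
    refine le_antisymm ?_ (integral_nonneg_of_ae hnn)
    simp only [← hright]
    rw [← hswap, hleft]
    exact mul_nonpos_of_nonneg_of_nonpos gaussConst_pos.le hE
  refine Measure.ae_ae_of_ae_prod (p := fun q : ℝ × E3 => gaussAvg σ q.1 q.2 = 0) ?_
  filter_upwards [(integral_eq_zero_iff_of_nonneg_ae hnn hint).1 hzero,
    ae_restrict_prod_fst_pos] with q hq hpos
  simpa [hpos.ne'] using hq

/-- The pairing of `σ` with the mollification at scale `s` of `g` by a Gaussian. -/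
def mollPairing (σ g : E3 → ℝ) (s : ℝ) : ℝ :=
  ∫ p : E3 × E3, σ p.1 * (g (p.1 + s • p.2) * exp (-2 * ‖p.2‖ ^ 2))

lemma integrable_mollPairing_bound {σ : E3 → ℝ} (hi : Integrable σ) (C : ℝ) :
    Integrable (fun p : E3 × E3 => |σ p.1| * (C * exp (-2 * ‖p.2‖ ^ 2))) :=
  hi.abs.mul_prod ((integrable_exp_neg_mul_norm_sq two_pos).const_mul C)

lemma norm_mollPairing_integrand_le {σ g : E3 → ℝ} {C : ℝ} (hC : ∀ x, ‖g x‖ ≤ C) (s : ℝ)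
    (p : E3 × E3) : ‖σ p.1 * (g (p.1 + s • p.2) * exp (-2 * ‖p.2‖ ^ 2))‖ ≤
      |σ p.1| * (C * exp (-2 * ‖p.2‖ ^ 2)) := by
  rw [norm_mul, norm_mul, norm_eq_abs (σ p.1), norm_of_nonneg (exp_pos _).le]
  gcongr
  exact hC _

lemma continuous_mollPairing {σ g : E3 → ℝ} (hm : Measurable σ) (hi : Integrable σ)
    (hg : Continuous g) {C : ℝ} (hC : ∀ x, ‖g x‖ ≤ C) : Continuous (mollPairing σ g) := by
  refine continuous_of_dominated (fun s => ?_)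
    (fun s => ae_of_all _ (norm_mollPairing_integrand_le hC s))
    (integrable_mollPairing_bound hi C) (ae_of_all _ fun p => by fun_prop)
  exact Measurable.aestronglyMeasurable (by fun_prop)

lemma mollPairing_zero (σ g : E3 → ℝ) :
    mollPairing σ g 0 = (∫ x, σ x * g x) * ∫ w : E3, exp (-2 * ‖w‖ ^ 2) := by
  unfold mollPairing
  rw [Measure.volume_eq_prod, ← integral_prod_mul]
  simp [mul_assoc]

lemma mollPairing_eq_zero {σ g : E3 → ℝ} (hm : Measurable σ) (hi : Integrable σ)
    (hg : Continuous g) (hgi : Integrable g) {C : ℝ} (hC : ∀ x, ‖g x‖ ≤ C) {s : ℝ} (hs : 0 < s)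
    (h0 : ∀ᵐ z, gaussAvg σ (s ^ 2)⁻¹ z = 0) : mollPairing σ g s = 0 := by
  have hint : Integrable (fun p : E3 × E3 => σ p.1 * (g (p.1 + s • p.2) * exp (-2 * ‖p.2‖ ^ 2))) :=
    (integrable_mollPairing_bound hi C).mono' (Measurable.aestronglyMeasurable (by fun_prop))
      (ae_of_all _ (norm_mollPairing_integrand_le hC s))
  have hinner : ∀ x, ∫ w, g (x + s • w) * exp (-2 * ‖w‖ ^ 2) =
      |(s ^ 3)⁻¹| * ∫ z, g z * exp (-(2 * (s ^ 2)⁻¹) * ‖x - z‖ ^ 2) := fun x => by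
    have h1 := Measure.integral_comp_smul (volume : Measure E3)
      (fun u => g (x + u) * exp (-(2 * (s ^ 2)⁻¹) * ‖x - (x + u)‖ ^ 2)) s
    rw [integral_add_left_eq_self (fun z => g z * exp (-(2 * (s ^ 2)⁻¹) * ‖x - z‖ ^ 2)) x,
      E3.finrank_eq, smul_eq_mul] at h1
    rw [← h1]
    congr 1; ext w; congr 2
    rw [sub_add_cancel_left, norm_neg, norm_smul, norm_of_nonneg hs.le]
    field_simp
  have hswap : Integrable (Function.uncurry fun x z =>
      σ x * (g z * exp (-(2 * (s ^ 2)⁻¹) * ‖x - z‖ ^ 2))) (volume.prod (volume : Measure E3)) := by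
    refine (hi.abs.mul_prod hgi.abs).mono' (Measurable.aestronglyMeasurable ?_)
      (ae_of_all _ fun p => ?_)
    · simp only [Function.uncurry_def]; fun_prop
    · simp only [Function.uncurry, norm_mul, ← norm_eq_abs, norm_of_nonneg (exp_pos _).le]
      gcongr
      refine mul_le_of_le_one_right (norm_nonneg _) (exp_le_one_iff.2 ?_)
      rw [neg_mul]
      exact neg_nonpos.2 (by positivity)
  unfold mollPairing
  rw [Measure.volume_eq_prod, integral_prod _ hint]
  simp only [integral_const_mul, hinner, mul_left_comm (σ _) |(s ^ 3)⁻¹|]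
  simp only [← integral_const_mul (σ _)]
  rw [integral_integral_swap hswap]
  have : ∀ z, ∫ x, σ x * (g z * exp (-(2 * (s ^ 2)⁻¹) * ‖x - z‖ ^ 2)) =
      g z * gaussAvg σ (s ^ 2)⁻¹ z := fun z => by
    simp only [mul_left_comm (σ _), integral_const_mul, gaussAvg]
  simp only [this]
  rw [integral_congr_ae (g := 0) (by filter_upwards [h0] with z hz; simp [hz])]
  simp

lemma ae_eq_zero_of_gaussAvg {σ : E3 → ℝ} (hm : Measurable σ) (hi : Integrable σ)
    (h : ∀ᵐ t ∂(volume.restrict (Ioi (0 : ℝ))), ∀ᵐ z, gaussAvg σ t z = 0) :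
    ∀ᵐ x, σ x = 0 := by
  refine ae_eq_zero_of_integral_contDiff_smul_eq_zero hi.locallyIntegrable fun g hg hgs => ?_
  obtain ⟨C, hC⟩ := hgs.exists_bound_of_continuous hg.continuous
  have hgi : Integrable g := hg.continuous.integrable_of_hasCompactSupport hgs
  have hex : ∀ n : ℕ, ∃ t : ℝ, n < t ∧ ∀ᵐ z, gaussAvg σ t z = 0 := fun n => by
    have h' : ∀ᵐ t ∂(volume.restrict (Ioi (n : ℝ))), ∀ᵐ z, gaussAvg σ t z = 0 :=
      ae_mono (Measure.restrict_mono (Ioi_subset_Ioi n.cast_nonneg) le_rfl) h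
    have : (ae (volume.restrict (Ioi (n : ℝ)))).NeBot := by
      rw [ae_neBot, Ne, Measure.restrict_eq_zero]; simp
    exact ((ae_restrict_mem measurableSet_Ioi).and h').exists
  choose t ht h0 using hex
  have htpos : ∀ n, 0 < t n := fun n => n.cast_nonneg.trans_lt (ht n)
  have hlim : Tendsto (fun n => √(t n)⁻¹) atTop (𝓝 0) := by
    have : Tendsto t atTop atTop :=
      tendsto_atTop_mono (fun n => (ht n).le) tendsto_natCast_atTop_atTop
    simpa using (tendsto_inv_atTop_zero.comp this).sqrt
  have hz : ∀ n, mollPairing σ g √(t n)⁻¹ = 0 := fun n => by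
    have := htpos n
    refine mollPairing_eq_zero hm hi hg.continuous hgi hC (by positivity) ?_
    rw [sq_sqrt (by positivity), inv_inv]
    exact h0 n
  have hl := ((continuous_mollPairing hm hi hg.continuous hC).tendsto 0).comp hlim
  simp only [Function.comp_def, hz] at hl
  have h00 := tendsto_nhds_unique hl tendsto_const_nhds
  rw [mollPairing_zero, GaussianFourier.integral_rexp_neg_mul_sq_norm two_pos] at h00
  have hp : (π / 2) ^ ((Module.finrank ℝ E3 : ℝ) / 2) ≠ 0 := by positivity
  simpa [mul_comm] using (mul_eq_zero.1 h00).resolve_right hp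

/-- Strict positive definiteness of the Coulomb kernel. -/
theorem ae_eq_zero_of_coulomb_energy_nonpos {σ : E3 → ℝ} (hσ : ∀ y, |σ y| ≤ 1)
    (hm : Measurable σ) (hi : Integrable σ)
    (hE : ∫ p : E3 × E3, σ p.1 * σ p.2 * coul p.1 p.2 ≤ 0) : ∀ᵐ x, σ x = 0 :=
  ae_eq_zero_of_gaussAvg hm hi (ae_gaussAvg_eq_zero hσ hm hi hE)

lemma abs_indicator_one_sub_indicator_one_le (A B : Set E3) (y : E3) :
    |A.indicator (fun _ => (1 : ℝ)) y - B.indicator (fun _ => (1 : ℝ)) y| ≤ 1 := by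
  by_cases hA : y ∈ A <;> by_cases hB : y ∈ B <;> simp [hA, hB]

lemma measurable_indicator_one_sub {A B : Set E3} (hA : MeasurableSet A) (hB : MeasurableSet B) :
    Measurable fun y => A.indicator (fun _ => (1 : ℝ)) y - B.indicator (fun _ => (1 : ℝ)) y :=
  (measurable_const.indicator hA).sub (measurable_const.indicator hB)

lemma integrable_indicator_one_sub {A B : Set E3} (hA : MeasurableSet A) (hB : MeasurableSet B)
    (hA' : volume A < ⊤) (hB' : volume B < ⊤) :
    Integrable fun y => A.indicator (fun _ => (1 : ℝ)) y - B.indicator (fun _ => (1 : ℝ)) y :=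
  ((integrable_indicator_iff hA).2 (integrableOn_const hA'.ne)).sub
    ((integrable_indicator_iff hB).2 (integrableOn_const hB'.ne))

lemma potential_sub_potential {A B C : Set E3} (hA : MeasurableSet A) (hB : MeasurableSet B)
    (hC : MeasurableSet C) (hA' : volume A < ⊤) (hB' : volume B < ⊤) (hC' : volume C < ⊤)
    (x : E3) : potential A B x - potential A C x = potential C B x := by
  have h : ∀ {D : Set E3}, MeasurableSet D → volume D < ⊤ → Integrable fun y =>
      (A.indicator (fun _ => (1 : ℝ)) y - D.indicator (fun _ => (1 : ℝ)) y) * coul x y :=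
    fun hD hD' => integrable_mul_coul (abs_indicator_one_sub_indicator_one_le A _)
      (measurable_indicator_one_sub hA hD) (integrable_indicator_one_sub hA hD hA' hD') x
  unfold potential
  rw [← integral_sub (h hB hB') (h hC hC')]
  congr 1; ext y; ring

/-- **Remark 4.2**: the screening property (nonnegative potential vanishing
a.e. outside `Ω⁺ ∪ Ω⁻`) uniquely determines the configuration up to a Lebesgue
null set, and the two potentials coincide everywhere. -/
theorem screening_determines_configuration
    (Ωp : Set E3) (ho : IsOpen Ωp) (hb : Bornology.IsBounded Ωp)
    (Ωm₁ Ωm₂ : Set E3)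
    (hmeas₁ : MeasurableSet Ωm₁) (hmeas₂ : MeasurableSet Ωm₂)
    (hfin₁ : volume Ωm₁ < ⊤) (hfin₂ : volume Ωm₂ < ⊤)
    (hdisj₁ : volume (Ωp ∩ Ωm₁) = 0) (hdisj₂ : volume (Ωp ∩ Ωm₂) = 0)
    (hpos₁ : ∀ x, 0 ≤ potential Ωp Ωm₁ x)
    (hpos₂ : ∀ x, 0 ≤ potential Ωp Ωm₂ x)
    (hscr₁ : ∀ᵐ x ∂(volume.restrict (Ωp ∪ Ωm₁)ᶜ), potential Ωp Ωm₁ x = 0)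
    (hscr₂ : ∀ᵐ x ∂(volume.restrict (Ωp ∪ Ωm₂)ᶜ), potential Ωp Ωm₂ x = 0) :
    (∀ x, potential Ωp Ωm₁ x = potential Ωp Ωm₂ x) ∧
      volume (symmDiff Ωm₁ Ωm₂) = 0 := by
  have hmp := ho.measurableSet
  have hfinp : volume Ωp < ⊤ := hb.measure_lt_top
  set σ : E3 → ℝ := fun y =>
    Ωm₂.indicator (fun _ => (1 : ℝ)) y - Ωm₁.indicator (fun _ => (1 : ℝ)) y with hσdef
  have hσ : ∀ y, |σ y| ≤ 1 := abs_indicator_one_sub_indicator_one_le Ωm₂ Ωm₁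
  have hm : Measurable σ := measurable_indicator_one_sub hmeas₂ hmeas₁
  have hi : Integrable σ := integrable_indicator_one_sub hmeas₂ hmeas₁ hfin₂ hfin₁
  have hdiff : ∀ x, potential Ωp Ωm₁ x - potential Ωp Ωm₂ x = ∫ y, σ y * coul x y :=
    potential_sub_potential hmp hmeas₁ hmeas₂ hfinp hfin₁ hfin₂
  have hE : ∫ p : E3 × E3, σ p.1 * σ p.2 * coul p.1 p.2 ≤ 0 := by
    rw [Measure.volume_eq_prod, integral_prod _ (integrable_mul_mul_coul hσ hm hi)]
    simp only [mul_assoc, integral_const_mul, ← hdiff]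
    refine integral_nonpos_of_ae ?_
    filter_upwards [(ae_restrict_iff' (hmp.union hmeas₁).compl).1 hscr₁,
      (ae_restrict_iff' (hmp.union hmeas₂).compl).1 hscr₂,
      compl_mem_ae_iff.2 hdisj₁, compl_mem_ae_iff.2 hdisj₂] with x h1 h2 h3 h4
    have hp₁ := hpos₁ x
    have hp₂ := hpos₂ x
    simp only [mem_compl_iff, mem_union, mem_inter_iff] at h1 h2 h3 h4
    by_cases hx₁ : x ∈ Ωm₁ <;> by_cases hx₂ : x ∈ Ωm₂
    · simp [hσdef, hx₁, hx₂]
    · have := h2 (by tauto)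
      simp [hσdef, hx₁, hx₂, this, hp₁]
    · have := h1 (by tauto)
      simp [hσdef, hx₁, hx₂, this, hp₂]
    · simp [hσdef, hx₁, hx₂]
  have h0 := ae_eq_zero_of_coulomb_energy_nonpos hσ hm hi hE
  refine ⟨fun x => ?_, ?_⟩
  · rw [← sub_eq_zero, hdiff]
    exact integral_eq_zero_of_ae (by filter_upwards [h0] with y hy; simp [hy])
  · refine measure_mono_null (fun x hx => ?_) h0
    rcases hx with ⟨h, h'⟩ | ⟨h, h'⟩ <;> simp [hσdef, h, h']
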